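/- arXiv:2505.09043 — 6 statements merged into one kernel-verified Lean document; each statement's English description precedes it below -/
import Mathlib

section
/- Identifiability of the hierarchical factor model (Theorem 1): Suppose Σ* = Λ*(Λ*)ᵀ + Ψ*, where Λ* ∈ ℝ^{J×K} has rank K and follows a hierarchical factor structure satisfying constraints C1–C3, and Ψ* is a J×J diagonal matrix with positive diagonal entries (Condition 1). Assume the separation Condition 2: for any J×K matrix Λ and J×J diagonal matrix Ψ with Λ*(Λ*)ᵀ + Ψ* = ΛΛᵀ + Ψ, one has ΛΛᵀ = Λ*(Λ*)ᵀ and Ψ = Ψ*. Assume the rank Condition 3 on Λ*. Then for every J×K matrix Λ following a hierarchical factor structure satisfying constraints C1–C4 and every J×J diagonal matrix Ψ with positive diagonal entries such that ΛΛᵀ + Ψ = Σ*, there exists a K×K diagonal matrix Q whose diagonal entries all lie in {1, −1} such that Λ = Λ*Q (and consequently Ψ = Ψ*). -/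
open Matrix Set

noncomputable section

/-- The set of variables (rows) loading on factor `k`, i.e. with nonzero loading. -/
def vSet {J K : ℕ} (Λ : Matrix (Fin J) (Fin K) ℝ) (k : Fin K) : Set (Fin J) :=
  {j | Λ j k ≠ 0}

/-- The set of descendant factors of factor `k`: those whose loading set is strictly
contained in that of `k`. -/
def descendants {J K : ℕ} (Λ : Matrix (Fin J) (Fin K) ℝ) (k : Fin K) : Set (Fin K) :=
  {l | vSet Λ l ⊂ vSet Λ k}

/-- Factor `l` is a child factor of factor `k`: it is a descendant of `k` with no
intermediate factor in between. -/
def IsChild {J K : ℕ} (Λ : Matrix (Fin J) (Fin K) ℝ) (k l : Fin K) : Prop :=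
  vSet Λ l ⊂ vSet Λ k ∧ ¬ ∃ k' : Fin K, vSet Λ l ⊂ vSet Λ k' ∧ vSet Λ k' ⊂ vSet Λ k

/-- The set of child factors of factor `k`. -/
def children {J K : ℕ} (Λ : Matrix (Fin J) (Fin K) ℝ) (k : Fin K) : Set (Fin K) :=
  {l | IsChild Λ k l}

/-- Constraint C1: the first factor is a general factor loaded by all variables. -/
def C1 {J K : ℕ} [NeZero K] (Λ : Matrix (Fin J) (Fin K) ℝ) : Prop :=
  vSet Λ 0 = Set.univ

/-- Constraint C2: for `k < l`, the loading set of `l` is either strictly contained in that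
of `k`, or disjoint from it. -/
def C2 {J K : ℕ} (Λ : Matrix (Fin J) (Fin K) ℝ) : Prop :=
  ∀ k l : Fin K, k < l → vSet Λ l ⊂ vSet Λ k ∨ Disjoint (vSet Λ l) (vSet Λ k)

/-- Constraint C3: each factor has zero or at least two children; the loading sets of the
children of a factor partition its loading set; and the factor labels respect (a) the order
of the minimal variable labels among siblings, and (b) the order of the parents' labels. -/
def C3 {J K : ℕ} (Λ : Matrix (Fin J) (Fin K) ℝ) : Prop :=
  (∀ k : Fin K, children Λ k = ∅ ∨ 2 ≤ (children Λ k).ncard) ∧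
  (∀ k : Fin K, (children Λ k).Nonempty →
    ((children Λ k).Pairwise fun l l' => Disjoint (vSet Λ l) (vSet Λ l')) ∧
    (⋃ l ∈ children Λ k, vSet Λ l) = vSet Λ k) ∧
  -- (a) siblings are labelled according to the minimal labels of their loading sets
  (∀ p k l : Fin K, IsChild Λ p k → IsChild Λ p l →
    (∃ j ∈ vSet Λ k, ∀ j' ∈ vSet Λ l, j < j') → k < l) ∧
  -- (b) factors with different parents are labelled according to their parents' labels
  (∀ p p' k l : Fin K, IsChild Λ p k → IsChild Λ p' l → p ≠ p' → p < p' → k < l)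

/-- Constraint C4: each factor is loaded by at least 3 variables, and by at least 7 if it
has two or more children. -/
def C4 {J K : ℕ} (Λ : Matrix (Fin J) (Fin K) ℝ) : Prop :=
  ∀ k : Fin K, 3 ≤ (vSet Λ k).ncard ∧ (2 ≤ (children Λ k).ncard → 7 ≤ (vSet Λ k).ncard)

/-- The submatrix of `Λ` with rows in `S` and columns in `T` has full column rank,
i.e. its columns are linearly independent. -/
def FullColRank {J K : ℕ} (Λ : Matrix (Fin J) (Fin K) ℝ) (S : Set (Fin J))
    (T : Set (Fin K)) : Prop :=
  LinearIndependent ℝ (fun c : T => fun r : S => Λ r.1 c.1)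

/-- The rank Condition 3 of the paper, imposed on the true loading matrix. -/
def Cond3 {J K : ℕ} (Λ : Matrix (Fin J) (Fin K) ℝ) : Prop :=
  ∀ i j : Fin K, (children Λ i).Nonempty → j ∈ children Λ i →
    -- (1) any two rows of Λ_[v_j, {i,j}] are linearly independent
    (∀ r1 ∈ vSet Λ j, ∀ r2 ∈ vSet Λ j, r1 ≠ r2 →
      LinearIndependent ℝ ![![Λ r1 i, Λ r1 j], ![Λ r2 i, Λ r2 j]]) ∧
    -- (2) Λ_[v_j \ {k}, {i,j} ∪ D_j] has full column rank for every k ∈ v_j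
    (∀ k ∈ vSet Λ j, FullColRank Λ (vSet Λ j \ {k}) ({i, j} ∪ descendants Λ j)) ∧
    -- (3) if j has at least two children, certain 4×4 submatrices are invertible
    (2 ≤ (children Λ j).ncard →
      ∀ s1 ∈ children Λ j, ∀ s2 ∈ children Λ j, s1 ≠ s2 →
      ∀ k1 ∈ vSet Λ s1, ∀ k2 ∈ vSet Λ s1, k1 ≠ k2 →
      ∀ k3 ∈ vSet Λ s2, ∀ k4 ∈ vSet Λ s2, k3 ≠ k4 →
        (!![Λ k1 i, Λ k1 j, Λ k1 s1, Λ k1 s2;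
            Λ k2 i, Λ k2 j, Λ k2 s1, Λ k2 s2;
            Λ k3 i, Λ k3 j, Λ k3 s1, Λ k3 s2;
            Λ k4 i, Λ k4 j, Λ k4 s1, Λ k4 s2]).det ≠ 0)

section Hierarchy

open scoped Classical

variable {J K : ℕ}

/-- The unlabelled part of a hierarchical factor structure: nonempty loading sets, and
constraints C2 and C3. -/
structure IsHierarchical (A : Matrix (Fin J) (Fin K) ℝ) : Prop where
  nonempty : ∀ k, (vSet A k).Nonempty
  c2 : C2 A
  c3 : C3 A

/-- The Gram kernel of the factors whose loading set is contained in that of `p`. -/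
def subtreeGram (A : Matrix (Fin J) (Fin K) ℝ) (p : Fin K) (x y : Fin J) : ℝ :=
  ∑ d with vSet A d ⊆ vSet A p, A x d * A y d

lemma subtreeGram_comm (A : Matrix (Fin J) (Fin K) ℝ) (p : Fin K) (x y : Fin J) :
    subtreeGram A p x y = subtreeGram A p y x := by
  simp only [subtreeGram, mul_comm]

lemma subtreeGram_eq_zero {A : Matrix (Fin J) (Fin K) ℝ} {p : Fin K} {y : Fin J}
    (hy : y ∉ vSet A p) (x : Fin J) : subtreeGram A p x y = 0 := by
  refine Finset.sum_eq_zero fun d hd => ?_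
  have : A y d = 0 := by
    by_contra h
    exact hy ((Finset.mem_filter.1 hd).2 h)
  simp [this]

namespace IsHierarchical

variable {A B : Matrix (Fin J) (Fin K) ℝ}

lemma lt_of_ssubset (hA : IsHierarchical A) {k l : Fin K} (h : vSet A l ⊂ vSet A k) : k < l := by
  rcases lt_trichotomy k l with hkl | rfl | hkl
  · exact hkl
  · exact absurd h (ssubset_irrefl _)
  · rcases hA.c2 l k hkl with h' | h'
    · exact absurd (h.trans h') (ssubset_irrefl _)
    · obtain ⟨x, hx⟩ := hA.nonempty l
      exact absurd hx (Set.disjoint_left.1 h' (h.subset hx))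

lemma vSet_injective (hA : IsHierarchical A) : Function.Injective (vSet A) := by
  intro k l h
  obtain ⟨x, hx⟩ := hA.nonempty k
  rcases lt_trichotomy k l with hkl | hkl | hkl
  · rcases hA.c2 k l hkl with h' | h'
    · exact absurd h.symm h'.ne
    · exact absurd hx (Set.disjoint_left.1 h' (h ▸ hx))
  · exact hkl
  · rcases hA.c2 l k hkl with h' | h'
    · exact absurd h h'.ne
    · exact absurd (h ▸ hx) (Set.disjoint_left.1 h' hx)

lemma exists_child_of_ssubset {k l : Fin K} (h : vSet A l ⊂ vSet A k) :
    ∃ c ∈ children A k, vSet A l ⊆ vSet A c := by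
  obtain ⟨c, hc, hmax⟩ :=
    (Set.toFinite {c | vSet A l ⊆ vSet A c ∧ vSet A c ⊂ vSet A k}).exists_maximalFor
      (vSet A) _ ⟨l, subset_rfl, h⟩
  refine ⟨c, ⟨hc.2, ?_⟩, hc.1⟩
  rintro ⟨k', h1, h2⟩
  exact h1.not_subset (hmax (j := k') ⟨hc.1.trans h1.subset, h2⟩ h1.subset)

lemma exists_child_mem (hA : IsHierarchical A) {k c : Fin K} (hc : c ∈ children A k) {x : Fin J}
    (hx : x ∈ vSet A k) : ∃ d ∈ children A k, x ∈ vSet A d := by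
  have := (hA.c3.2.1 k ⟨c, hc⟩).2
  rw [← this] at hx
  simpa using hx

lemma child_unique (hA : IsHierarchical A) {k c d : Fin K} (hc : c ∈ children A k)
    (hd : d ∈ children A k) {x : Fin J} (hxc : x ∈ vSet A c) (hxd : x ∈ vSet A d) : c = d := by
  by_contra h
  exact Set.disjoint_left.1 ((hA.c3.2.1 k ⟨c, hc⟩).1 hc hd h) hxc hxd

lemma exists_sibling (hA : IsHierarchical A) {k c : Fin K} (hc : c ∈ children A k) :
    ∃ d ∈ children A k, d ≠ c := by
  rcases hA.c3.1 k with h | h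
  · simp [h] at hc
  · exact Set.exists_ne_of_one_lt_ncard (by omega) c

/-- The Gram kernel splits off the top factor along a child. -/
lemma subtreeGram_child (hA : IsHierarchical A) {p c : Fin K} (hc : c ∈ children A p) {x : Fin J}
    (hx : x ∈ vSet A c) (y : Fin J) :
    subtreeGram A p x y = A x p * A y p + subtreeGram A c x y := by
  have hp : p ∉ Finset.univ.filter fun d => vSet A d ⊆ vSet A c := by
    simpa using hc.1.not_subset
  rw [subtreeGram, subtreeGram, ← Finset.sum_insert (f := fun d => A x d * A y d) hp]
  symm
  refine Finset.sum_subset ?_ ?_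
  · intro d hd
    simp only [Finset.mem_insert, Finset.mem_filter, Finset.mem_univ, true_and] at hd ⊢
    rcases hd with rfl | hd
    · exact subset_rfl
    · exact hd.trans hc.1.subset
  · intro d hd hd'
    simp only [Finset.mem_insert, Finset.mem_filter, Finset.mem_univ, true_and, not_or] at hd hd'
    by_cases hxd : x ∈ vSet A d
    · exfalso
      have hlt : vSet A d ⊂ vSet A p :=
        hd.ssubset_of_ne fun h => hd'.1 (hA.vSet_injective h)
      obtain ⟨e, he, hde⟩ := exists_child_of_ssubset hlt
      rw [← hA.child_unique hc he hx (hde hxd)] at hde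
      exact hd'.2 hde
    · have : A x d = 0 := by simpa [vSet] using hxd
      simp [this]

lemma subtreeGram_across (hA : IsHierarchical A) {p c : Fin K} (hc : c ∈ children A p) {x y : Fin J}
    (hx : x ∈ vSet A c) (hy : y ∉ vSet A c) : subtreeGram A p x y = A x p * A y p := by
  rw [hA.subtreeGram_child hc hx, subtreeGram_eq_zero hy, add_zero]

lemma subtreeGram_leaf (hA : IsHierarchical A) {p : Fin K} (hp : children A p = ∅) (x y : Fin J) :
    subtreeGram A p x y = A x p * A y p := by
  have : (Finset.univ.filter fun d => vSet A d ⊆ vSet A p) = {p} := by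
    ext d
    simp only [Finset.mem_filter, Finset.mem_univ, true_and, Finset.mem_singleton]
    refine ⟨fun hd => ?_, fun hd => hd ▸ subset_rfl⟩
    by_contra hne
    obtain ⟨c, hc, -⟩ :=
      exists_child_of_ssubset (hd.ssubset_of_ne fun h => hne (hA.vSet_injective h))
    simp [hp] at hc
  rw [subtreeGram, this, Finset.sum_singleton]

/-- A leaf kernel cannot be reproduced by a factor having children. -/
lemma children_eq_empty (hA : IsHierarchical A) (hB : IsHierarchical B) {p q : Fin K}
    (hv : vSet B p = vSet A q)
    (hG : ∀ x ∈ vSet A q, ∀ y ∈ vSet A q, subtreeGram B p x y = subtreeGram A q x y)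
    (hq : children A q = ∅) : children B p = ∅ := by
  by_contra hne
  obtain ⟨d, hd⟩ := Set.nonempty_iff_ne_empty.2 hne
  obtain ⟨y, hy⟩ := hB.nonempty d
  obtain ⟨x, hx, hxd⟩ := Set.exists_of_ssubset hd.1
  have hyq : y ∈ vSet A q := hv ▸ hd.1.subset hy
  have hxq : x ∈ vSet A q := hv ▸ hx
  have h0 : ∑ e with vSet B e ⊆ vSet B p, (A y q * B x e - A x q * B y e) ^ 2 = 0 := by
    have : ∑ e with vSet B e ⊆ vSet B p, (A y q * B x e - A x q * B y e) ^ 2 =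
        A y q ^ 2 * subtreeGram B p x x - 2 * A x q * A y q * subtreeGram B p x y
          + A x q ^ 2 * subtreeGram B p y y := by
      simp only [subtreeGram, Finset.mul_sum, ← Finset.sum_sub_distrib, ← Finset.sum_add_distrib]
      exact Finset.sum_congr rfl fun e _ => by ring
    rw [this, hG x hxq x hxq, hG x hxq y hyq, hG y hyq y hyq, hA.subtreeGram_leaf hq,
      hA.subtreeGram_leaf hq, hA.subtreeGram_leaf hq]
    ring
  have h1 := (Finset.sum_eq_zero_iff_of_nonneg fun e _ => sq_nonneg _).1 h0 d
    (by simpa using hd.1.subset)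
  have hxd' : B x d = 0 := by simpa [vSet] using hxd
  have hxq' : A x q ≠ 0 := hxq
  have hy' : B y d ≠ 0 := hy
  simp [hxd', hxq', hy'] at h1

/-- Coefficient form of the full-column-rank part of the rank condition. -/
lemma coeff_eq_zero (hA : IsHierarchical A) (h3 : Cond3 A) {i j : Fin K} (hj : j ∈ children A i) {k : Fin J}
    (hk : k ∈ vSet A j) (μ : ℝ) (c : Fin K → ℝ)
    (h : ∀ y ∈ vSet A j, y ≠ k → μ * A y i + ∑ d with vSet A d ⊆ vSet A j, c d * A y d = 0) :
    μ = 0 ∧ ∀ d, vSet A d ⊆ vSet A j → c d = 0 := by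
  have hli := (h3 i j ⟨j, hj⟩ hj).2.1 k hk
  rw [FullColRank, Fintype.linearIndependent_iff] at hli
  have hi : ¬ vSet A i ⊆ vSet A j := hj.1.not_subset
  have hset : ∀ d, d ∈ ({i, j} ∪ descendants A j : Set (Fin K)) ↔
      d ∈ insert i (Finset.univ.filter fun d => vSet A d ⊆ vSet A j) := by
    intro d
    simp only [Set.mem_union, Set.mem_insert_iff, Set.mem_singleton_iff, descendants,
      Set.mem_ofPred_eq, Finset.mem_insert, Finset.mem_filter, Finset.mem_univ, true_and]
    constructor
    · rintro ((h | rfl) | h)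
      · exact Or.inl h
      · exact Or.inr subset_rfl
      · exact Or.inr h.subset
    · rintro (h | h)
      · exact Or.inl (Or.inl h)
      · by_cases hd : d = j
        · exact Or.inl (Or.inr hd)
        · exact Or.inr (h.ssubset_of_ne fun h' => hd (hA.vSet_injective h'))
  have hz := hli (fun d => if d.1 = i then μ else c d.1) ?_
  · refine ⟨by simpa using hz ⟨i, by simp⟩, fun d hd => ?_⟩
    have hdi : d ≠ i := fun h' => hi (h' ▸ hd)
    simpa [hdi] using hz ⟨d, (hset d).2 (by simp [hd])⟩
  · ext r
    have := h r.1 r.2.1 r.2.2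
    simp only [Finset.sum_apply, Pi.smul_apply, smul_eq_mul, Pi.zero_apply]
    rw [← this, ← Finset.sum_subtype (insert i (Finset.univ.filter fun d => vSet A d ⊆ vSet A j))
      (fun d => (hset d).symm) (fun d => (if d = i then μ else c d) * A r.1 d),
      Finset.sum_insert (by simpa using hi)]
    simp only [if_true]
    congr 1
    refine Finset.sum_congr rfl fun d hd => ?_
    rw [if_neg]
    rintro rfl
    exact hi (Finset.mem_filter.1 hd).2

lemma exists_mem_ne_ne (hA : IsHierarchical A) (h3 : Cond3 A) {i j : Fin K}
    (hj : j ∈ children A i) {x y : Fin J} (hx : x ∈ vSet A j) (hy : y ∈ vSet A j) :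
    ∃ w ∈ vSet A j, w ≠ x ∧ w ≠ y := by
  by_contra! H
  refine hy (hA.coeff_eq_zero h3 hj hx (A y j) (fun d => if d = j then -A y i else 0) ?_).1
  intro w hw hwx
  obtain rfl := H w hw hwx
  simp
  ring

lemma cross_ne (h3 : Cond3 A) {i j : Fin K} (hj : j ∈ children A i) {x y : Fin J}
    (hx : x ∈ vSet A j) (hy : y ∈ vSet A j) (hxy : x ≠ y) :
    A x j * A y i ≠ A y j * A x i := by
  intro h
  have hli := (h3 i j ⟨j, hj⟩ hj).1 x hx y hy hxy
  rw [LinearIndependent.pair_iff] at hli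
  refine hy (hli (A y j) (-A x j) ?_).1
  ext m
  fin_cases m
  · simp; linarith
  · simp; ring

/-- If the rows of a child block indexed by `U` all see the rest of the block through a
rank-one kernel, the rest has at most one element. -/
lemma false_of_proportional (hA : IsHierarchical A) (h3 : Cond3 A) {q s : Fin K}
    (hs : s ∈ children A q) {U : Set (Fin J)} {x y₁ y₂ : Fin J} (hx : x ∈ vSet A s) (hxU : x ∈ U)
    (hy₁ : y₁ ∈ vSet A s) (hy₁U : y₁ ∉ U) (hy₂ : y₂ ∈ vSet A s) (hy₂U : y₂ ∉ U) (hne : y₁ ≠ y₂)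
    (H : ∀ x ∈ vSet A s, x ∈ U → ∀ y ∈ vSet A s, y ∉ U → ∀ y' ∈ vSet A s, y' ∉ U →
      subtreeGram A s x y * A y' q = subtreeGram A s x y' * A y q) : False := by
  by_cases hleaf : children A s = ∅
  · have h := H x hx hxU y₁ hy₁ hy₁U y₂ hy₂ hy₂U
    rw [hA.subtreeGram_leaf hleaf, hA.subtreeGram_leaf hleaf] at h
    refine cross_ne h3 hs hy₁ hy₂ hne (mul_left_cancel₀ (show A x s ≠ 0 from hx) ?_)
    linarith
  obtain ⟨t₀, ht₀⟩ := Set.nonempty_iff_ne_empty.2 hleaf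
  have key : ∀ t ∈ children A s, ∀ x ∈ vSet A t, x ∈ U → ∀ y ∈ vSet A s, y ∉ U → y ∉ vSet A t →
      ∀ y' ∈ vSet A s, y' ∉ U → y' ∉ vSet A t → y = y' := by
    intro t ht x hx hxU y hy hyU hyt y' hy' hyU' hyt'
    by_contra hyy
    have hxs := ht.1.subset hx
    have h := H x hxs hxU y hy hyU y' hy' hyU'
    rw [hA.subtreeGram_across ht hx hyt, hA.subtreeGram_across ht hx hyt'] at h
    refine cross_ne h3 hs hy hy' hyy (mul_left_cancel₀ (show A x s ≠ 0 from hxs) ?_)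
    linarith
  obtain ⟨t₁, ht₁, hxt₁⟩ := hA.exists_child_mem ht₀ hx
  obtain ⟨t₂, ht₂, htne⟩ := hA.exists_sibling ht₁
  have hdisj : ∀ w, w ∈ vSet A t₁ → w ∉ vSet A t₂ := fun w h h' =>
    htne (hA.child_unique ht₂ ht₁ h' h)
  obtain ⟨z, hzt, hzU⟩ : ∃ z ∈ vSet A t₂, z ∈ U := by
    by_contra! hU
    obtain ⟨z, hz⟩ := hA.nonempty t₂
    obtain ⟨z', hz', hzz, -⟩ := hA.exists_mem_ne_ne h3 ht₂ hz hz
    exact hzz (key t₁ ht₁ x hxt₁ hxU z' (ht₂.1.subset hz') (hU z' hz') (fun h => hdisj _ h hz')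
      z (ht₂.1.subset hz) (hU z hz) (fun h => hdisj _ h hz))
  obtain ⟨y, hyt, hyU, y', hy', hyU', hyt'⟩ : ∃ y ∈ vSet A t₁, y ∉ U ∧ ∃ y' ∈ vSet A s, y' ∉ U ∧
      y' ∉ vSet A t₁ := by
    by_cases h1 : y₁ ∈ vSet A t₁ <;> by_cases h2 : y₂ ∈ vSet A t₁
    · exact absurd (key t₂ ht₂ z hzt hzU y₁ hy₁ hy₁U (hdisj _ h1) y₂ hy₂ hy₂U (hdisj _ h2)) hne
    · exact ⟨y₁, h1, hy₁U, y₂, hy₂, hy₂U, h2⟩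
    · exact ⟨y₂, h2, hy₂U, y₁, hy₁, hy₁U, h1⟩
    · exact absurd (key t₁ ht₁ x hxt₁ hxU y₁ hy₁ hy₁U h1 y₂ hy₂ hy₂U h2) hne
  have hy := ht₁.1.subset hyt
  have hc := (hA.coeff_eq_zero h3 ht₁ hyt (A y' q * A y s - A y q * A y' s)
    (fun d => A y' q * A y d) ?_).2 t₁ subset_rfl
  · exact mul_ne_zero (hs.1.subset hy') hyt hc
  · intro w hw hwy
    have hwU : w ∈ U := by
      by_contra hwU
      exact hwy (key t₂ ht₂ z hzt hzU w (ht₁.1.subset hw) hwU (hdisj _ hw) y hy hyU (hdisj _ hyt))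
    have h := H w (ht₁.1.subset hw) hwU y hy hyU y' hy' hyU'
    rw [hA.subtreeGram_across ht₁ hw hyt', hA.subtreeGram_child ht₁ hw] at h
    have hsum : ∑ d with vSet A d ⊆ vSet A t₁, A y' q * A y d * A w d =
        A y' q * subtreeGram A t₁ w y := by
      rw [subtreeGram, Finset.mul_sum]
      exact Finset.sum_congr rfl fun d _ => by ring
    rw [hsum]
    linarith

/-- A cut of `v_q` along which the kernel has rank one, both sides having two elements,
does not split a child block, provided some outside element lies in `U`. -/
lemma false_of_split (hA : IsHierarchical A) (h3 : Cond3 A) {q s : Fin K}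
    (hs : s ∈ children A q) {U : Set (Fin J)}
    (hcross : ∀ x ∈ vSet A q, x ∈ U → ∀ x' ∈ vSet A q, x' ∈ U → ∀ y ∈ vSet A q, y ∉ U →
      ∀ y' ∈ vSet A q, y' ∉ U → subtreeGram A q x y * subtreeGram A q x' y' =
        subtreeGram A q x y' * subtreeGram A q x' y)
    (h2 : ∀ y ∈ vSet A q, y ∉ U → ∃ z ∈ vSet A q, z ∉ U ∧ z ≠ y)
    {x y z : Fin J} (hx : x ∈ vSet A s) (hxU : x ∈ U) (hy : y ∈ vSet A s) (hyU : y ∉ U)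
    (hz : z ∈ vSet A q) (hzs : z ∉ vSet A s) (hzU : z ∈ U) : False := by
  have main : ∀ (V : Set (Fin J)), (∀ x ∈ vSet A q, x ∈ V → ∀ x' ∈ vSet A q, x' ∈ V →
      ∀ y ∈ vSet A q, y ∉ V → ∀ y' ∈ vSet A q, y' ∉ V → subtreeGram A q x y *
        subtreeGram A q x' y' = subtreeGram A q x y' * subtreeGram A q x' y) →
      ∀ x ∈ vSet A s, x ∈ V → ∀ y₁ ∈ vSet A s, y₁ ∉ V → ∀ y₂ ∈ vSet A s, y₂ ∉ V →
      ∀ z ∈ vSet A q, z ∉ vSet A s → z ∈ V → y₁ = y₂ := by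
    intro V hV x hx hxV y₁ hy₁ hy₁V y₂ hy₂ hy₂V z hz hzs hzV
    by_contra hne
    refine hA.false_of_proportional h3 hs hx hxV hy₁ hy₁V hy₂ hy₂V hne ?_
    intro x hx hxV y hy hyV y' hy' hyV'
    have h := hV x (hs.1.subset hx) hxV z hz hzV y (hs.1.subset hy) hyV y' (hs.1.subset hy') hyV'
    rw [subtreeGram_comm A q z y', subtreeGram_comm A q z y, hA.subtreeGram_across hs hy' hzs,
      hA.subtreeGram_across hs hy hzs, hA.subtreeGram_child hs hx, hA.subtreeGram_child hs hx] at h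
    refine mul_left_cancel₀ (show A z q ≠ 0 from hz) ?_
    linear_combination h
  obtain ⟨z', hz', hz'U, hz'y⟩ := h2 y (hs.1.subset hy) hyU
  have hz's : z' ∉ vSet A s := fun h =>
    hz'y (main U hcross x hx hxU z' h hz'U y hy hyU z hz hzs hzU)
  obtain ⟨w, hw, hwx, hwy⟩ := hA.exists_mem_ne_ne h3 hs hx hy
  have hwU : w ∈ U := by
    by_contra hwU
    exact hwy (main U hcross x hx hxU w hw hwU y hy hyU z hz hzs hzU)
  refine hwx (main Uᶜ ?_ y hy hyU w hw (by simpa using hwU) x hx (by simpa using hxU) z' hz' hz's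
    hz'U)
  intro a ha haU a' ha' haU' b hb hbU b' hb' hbU'
  rw [subtreeGram_comm A q a, subtreeGram_comm A q a', subtreeGram_comm A q a,
    subtreeGram_comm A q a', hcross b hb (by simpa using hbU) b' hb' (by simpa using hbU') a ha haU
      a' ha' haU']
  ring

lemma subset_or_disjoint (hA : IsHierarchical A) (h3 : Cond3 A) {q s : Fin K}
    (hs : s ∈ children A q) {U : Set (Fin J)}
    (hcross : ∀ x ∈ vSet A q, x ∈ U → ∀ x' ∈ vSet A q, x' ∈ U → ∀ y ∈ vSet A q, y ∉ U →
      ∀ y' ∈ vSet A q, y' ∉ U → subtreeGram A q x y * subtreeGram A q x' y' =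
        subtreeGram A q x y' * subtreeGram A q x' y)
    (h1 : ∀ y ∈ vSet A q, y ∈ U → ∃ z ∈ vSet A q, z ∈ U ∧ z ≠ y)
    (h2 : ∀ y ∈ vSet A q, y ∉ U → ∃ z ∈ vSet A q, z ∉ U ∧ z ≠ y) :
    vSet A s ⊆ U ∨ Disjoint (vSet A s) U := by
  by_contra hcon
  rw [not_or, Set.not_subset, Set.not_disjoint_iff] at hcon
  obtain ⟨⟨y, hy, hyU⟩, x, hx, hxU⟩ := hcon
  obtain ⟨z, hz, hzs⟩ := Set.exists_of_ssubset hs.1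
  by_cases hzU : z ∈ U
  · exact hA.false_of_split h3 hs hcross h2 hx hxU hy hyU hz hzs hzU
  · refine hA.false_of_split h3 hs (U := Uᶜ) ?_ (by simpa using h1) hy hyU hx (by simpa using hxU)
      hz hzs hzU
    intro a ha haU a' ha' haU' b hb hbU b' hb' hbU'
    rw [subtreeGram_comm A q a, subtreeGram_comm A q a', subtreeGram_comm A q a,
      subtreeGram_comm A q a', hcross b hb (by simpa using hbU) b' hb' (by simpa using hbU') a ha
        haU a' ha' haU']
    ring

/-- A vector supported on a child block, orthogonal to the factors of that block but not to
the parent factor. -/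
lemma exists_dual_vector (hA : IsHierarchical A) (h3 : Cond3 A) {q s : Fin K}
    (hs : s ∈ children A q) : ∃ w : Fin J → ℝ, (∀ y ∉ vSet A s, w y = 0) ∧
      ∑ y, w y * A y q ≠ 0 ∧ ∀ d, vSet A d ⊆ vSet A s → ∑ y, w y * A y d = 0 := by
  let f : Fin K → Fin J → ℝ := fun d y => if y ∈ vSet A s then A y d else 0
  have hf : f q ∉ Submodule.span ℝ
      (f '' (Finset.univ.filter fun d => vSet A d ⊆ vSet A s : Finset (Fin K))) := by
    rw [Submodule.mem_span_image_finset_iff_exists_fun']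
    rintro ⟨c, hc⟩
    obtain ⟨k, hk⟩ := hA.nonempty s
    have := (hA.coeff_eq_zero h3 hs hk (-1) c ?_).1
    · norm_num at this
    · intro y hy _
      have hcy := congrFun hc y
      simp only [Finset.sum_apply, Pi.smul_apply, smul_eq_mul, f, hy, if_true] at hcy
      rw [hcy]
      ring
  obtain ⟨φ, hφ, hker⟩ := Submodule.exists_le_ker_of_notMem hf
  have hsum : ∀ d, ∑ y, (if y ∈ vSet A s then φ (Pi.single y 1) else 0) * A y d = φ (f d) := by
    intro d
    conv_rhs => rw [pi_eq_sum_univ' (f d), map_sum]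
    refine Finset.sum_congr rfl fun y _ => ?_
    rw [map_smul, smul_eq_mul]
    by_cases hy : y ∈ vSet A s
    · simp only [f, hy, if_true]
      rw [mul_comm]
    · simp [f, hy]
  refine ⟨fun y => if y ∈ vSet A s then φ (Pi.single y 1) else 0, fun y hy => if_neg hy, ?_, ?_⟩
  · rw [hsum]
    exact hφ
  · intro d hd
    rw [hsum]
    exact hker (Submodule.subset_span ⟨d, by simpa using hd, rfl⟩)

lemma sum_sum_subtreeGram (A : Matrix (Fin J) (Fin K) ℝ) (p : Fin K) (w : Fin J → ℝ) :
    ∑ x, ∑ y, w x * w y * subtreeGram A p x y =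
      ∑ d with vSet A d ⊆ vSet A p, (∑ x, w x * A x d) ^ 2 := by
  simp only [subtreeGram, Finset.mul_sum, sq, Finset.sum_mul]
  rw [Finset.sum_comm' (t' := Finset.univ) (s' := fun _ => Finset.univ) (by simp)]
  rw [Finset.sum_comm' (s := Finset.univ.filter fun d => vSet A d ⊆ vSet A p)
    (t' := Finset.univ) (s' := fun _ => Finset.univ.filter fun d => vSet A d ⊆ vSet A p) (by simp)]
  refine Finset.sum_congr rfl fun y _ => ?_
  rw [Finset.sum_comm]
  refine Finset.sum_congr rfl fun d _ => Finset.sum_congr rfl fun x _ => by ring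

lemma sum_sum_subtreeGram_child (hA : IsHierarchical A) {p c : Fin K} (hc : c ∈ children A p)
    {w : Fin J → ℝ} (hw : ∀ y ∉ vSet A c, w y = 0) :
    ∑ x, ∑ y, w x * w y * subtreeGram A p x y = (∑ x, w x * A x p) ^ 2 +
      ∑ d with vSet A d ⊆ vSet A c, (∑ x, w x * A x d) ^ 2 := by
  rw [← sum_sum_subtreeGram, sq, Finset.sum_mul_sum, ← Finset.sum_add_distrib]
  refine Finset.sum_congr rfl fun x _ => ?_
  rw [← Finset.sum_add_distrib]
  refine Finset.sum_congr rfl fun y _ => ?_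
  by_cases hx : x ∈ vSet A c
  · rw [hA.subtreeGram_child hc hx]
    ring
  · simp [hw x hx]

lemma scale_sq_le_one (hA : IsHierarchical A) (hB : IsHierarchical B) (h3 : Cond3 A)
    {p q : Fin K}
    (hG : ∀ x ∈ vSet A q, ∀ y ∈ vSet A q, subtreeGram B p x y = subtreeGram A q x y)
    {a s : Fin K} (ha : a ∈ children B p) (hs : s ∈ children A q) (hsa : vSet A s ⊆ vSet B a)
    {c : ℝ} (hc : ∀ x ∈ vSet B a, B x p = c * A x q) : c ^ 2 ≤ 1 := by
  obtain ⟨w, hw, hw0, hwd⟩ := hA.exists_dual_vector h3 hs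
  have hAq := hA.sum_sum_subtreeGram_child hs hw
  have hBp := hB.sum_sum_subtreeGram_child ha (w := w) fun y hy => hw y fun h => hy (hsa h)
  have heq : ∑ x, ∑ y, w x * w y * subtreeGram B p x y =
      ∑ x, ∑ y, w x * w y * subtreeGram A q x y := by
    refine Finset.sum_congr rfl fun x _ => Finset.sum_congr rfl fun y _ => ?_
    by_cases hx : x ∈ vSet A s
    · by_cases hy : y ∈ vSet A s
      · rw [hG x (hs.1.subset hx) y (hs.1.subset hy)]
      · simp [hw y hy]
    · simp [hw x hx]
  have hwB : ∑ x, w x * B x p = c * ∑ x, w x * A x q := by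
    rw [Finset.mul_sum]
    refine Finset.sum_congr rfl fun x _ => ?_
    by_cases hx : x ∈ vSet A s
    · rw [hc x (hsa hx)]
      ring
    · simp [hw x hx]
  have hzero : ∑ d with vSet A d ⊆ vSet A s, (∑ x, w x * A x d) ^ 2 = 0 :=
    Finset.sum_eq_zero fun d hd => by rw [hwd d (Finset.mem_filter.1 hd).2]; ring
  have hnonneg : 0 ≤ ∑ d with vSet B d ⊆ vSet B a, (∑ x, w x * B x d) ^ 2 :=
    Finset.sum_nonneg fun d _ => sq_nonneg _
  rw [hBp, hAq, hzero, hwB] at heq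
  have hpos : 0 < (∑ y, w y * A y q) ^ 2 := by positivity
  by_contra! h
  nlinarith [mul_lt_mul_of_pos_right h hpos]

/-- A child block of `B` contains the child block of `A` through each of its elements. -/
lemma exists_child_subset (hA : IsHierarchical A) (hB : IsHierarchical B) (h3 : Cond3 A)
    (hB2 : ∀ k, ∀ x ∈ vSet B k, ∃ z ∈ vSet B k, z ≠ x)
    {p q : Fin K} (hv : vSet B p = vSet A q)
    (hG : ∀ x ∈ vSet A q, ∀ y ∈ vSet A q, subtreeGram B p x y = subtreeGram A q x y)
    (hq : (children A q).Nonempty) {a : Fin K} (ha : a ∈ children B p) {x : Fin J}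
    (hx : x ∈ vSet B a) : ∃ s ∈ children A q, x ∈ vSet A s ∧ vSet A s ⊆ vSet B a := by
  obtain ⟨s₀, hs₀⟩ := hq
  obtain ⟨s, hs, hxs⟩ := hA.exists_child_mem hs₀ (hv ▸ ha.1.subset hx)
  refine ⟨s, hs, hxs, ?_⟩
  refine (hA.subset_or_disjoint h3 hs (U := vSet B a) ?_ ?_ ?_).resolve_right
    fun h => Set.disjoint_left.1 h hxs hx
  · intro x hx hxa x' hx' hxa' y hy hya y' hy' hya'
    simp only [← hG _ hx _ hy, ← hG _ hx _ hy', ← hG _ hx' _ hy, ← hG _ hx' _ hy',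
      hB.subtreeGram_across ha hxa hya, hB.subtreeGram_across ha hxa hya',
      hB.subtreeGram_across ha hxa' hya, hB.subtreeGram_across ha hxa' hya']
    ring
  · intro y hy hya
    obtain ⟨z, hz, hzy⟩ := hB2 a y hya
    exact ⟨z, hv ▸ ha.1.subset hz, hz, hzy⟩
  · intro y hy hya
    obtain ⟨b, hb, hyb⟩ := hB.exists_child_mem ha (hv ▸ hy)
    obtain ⟨z, hz, hzy⟩ := hB2 b y hyb
    refine ⟨z, hv ▸ hb.1.subset hz, fun hza => hya ?_, hzy⟩
    rwa [hB.child_unique ha hb hza hz]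

/-- At a factor with children, the top column is determined up to sign. -/
lemma exists_sign (hA : IsHierarchical A) (hB : IsHierarchical B) (h3 : Cond3 A)
    (hB2 : ∀ k, ∀ x ∈ vSet B k, ∃ z ∈ vSet B k, z ≠ x)
    {p q : Fin K} (hv : vSet B p = vSet A q)
    (hG : ∀ x ∈ vSet A q, ∀ y ∈ vSet A q, subtreeGram B p x y = subtreeGram A q x y)
    (hq : (children A q).Nonempty) (hp : (children B p).Nonempty) :
    ∃ ε : ℝ, (ε = 1 ∨ ε = -1) ∧ ∀ x, B x p = ε * A x q := by
  have hacross : ∀ a ∈ children B p, ∀ x ∈ vSet B a, ∀ y ∈ vSet A q, y ∉ vSet B a →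
      B x p * B y p = A x q * A y q := by
    intro a ha x hx y hy hya
    obtain ⟨s, hs, hxs, hsa⟩ := hA.exists_child_subset hB h3 hB2 hv hG hq ha hx
    rw [← hB.subtreeGram_across ha hx hya, hG x (hs.1.subset hxs) y hy,
      hA.subtreeGram_across hs hxs fun h => hya (hsa h)]
  have hscale : ∀ a ∈ children B p, ∃ c : ℝ, c ^ 2 ≤ 1 ∧ ∀ x ∈ vSet B a, B x p = c * A x q := by
    intro a ha
    obtain ⟨y, hy, hya⟩ := Set.exists_of_ssubset ha.1
    have hy0 : B y p ≠ 0 := hy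
    obtain ⟨x, hx⟩ := hB.nonempty a
    obtain ⟨s, hs, -, hsa⟩ := hA.exists_child_subset hB h3 hB2 hv hG hq ha hx
    have hc : ∀ x ∈ vSet B a, B x p = A y q / B y p * A x q := by
      intro x hx
      field_simp
      linarith [hacross a ha x hx y (hv ▸ hy) hya]
    exact ⟨_, hA.scale_sq_le_one hB h3 hG ha hs hsa hc, hc⟩
  obtain ⟨a, ha⟩ := hp
  obtain ⟨c, hc1, hc⟩ := hscale a ha
  have hother : ∀ b ∈ children B p, b ≠ a →
      (c = 1 ∨ c = -1) ∧ ∀ x ∈ vSet B b, B x p = c * A x q := by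
    intro b hb hba
    obtain ⟨e, he1, he⟩ := hscale b hb
    obtain ⟨x, hx⟩ := hB.nonempty a
    obtain ⟨y, hy⟩ := hB.nonempty b
    have hxq : A x q ≠ 0 := show x ∈ vSet A q from hv ▸ ha.1.subset hx
    have hyq : A y q ≠ 0 := show y ∈ vSet A q from hv ▸ hb.1.subset hy
    have h := hacross a ha x hx y hyq fun h => hba (hB.child_unique hb ha hy h)
    rw [hc x hx, he y hy] at h
    have hce : c * e = 1 := by
      refine mul_right_cancel₀ (mul_ne_zero hxq hyq) ?_
      linarith
    have hec : c = e := by nlinarith [sq_nonneg (c - e)]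
    subst hec
    exact ⟨mul_self_eq_one_iff.1 hce, he⟩
  obtain ⟨b, hb, hba⟩ := hB.exists_sibling ha
  refine ⟨c, (hother b hb hba).1, fun x => ?_⟩
  by_cases hx : x ∈ vSet B p
  · obtain ⟨d, hd, hxd⟩ := hB.exists_child_mem ha hx
    by_cases hda : d = a
    · exact hc x (hda ▸ hxd)
    · exact (hother d hd hda).2 x hxd
  · have hx' : x ∉ vSet A q := hv ▸ hx
    simp only [vSet, Set.mem_ofPred_eq, not_not] at hx hx'
    simp [hx, hx']

lemma exists_child_eq (hA : IsHierarchical A) (hB : IsHierarchical B) (h3 : Cond3 A)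
    (hB2 : ∀ k, ∀ x ∈ vSet B k, ∃ z ∈ vSet B k, z ≠ x)
    {p q : Fin K} (hv : vSet B p = vSet A q)
    (hG : ∀ x ∈ vSet A q, ∀ y ∈ vSet A q, subtreeGram B p x y = subtreeGram A q x y)
    (hq : (children A q).Nonempty) {a : Fin K} (ha : a ∈ children B p) :
    ∃ s ∈ children A q, vSet B a = vSet A s ∧
      ∀ x ∈ vSet A s, ∀ y ∈ vSet A s, subtreeGram B a x y = subtreeGram A s x y := by
  obtain ⟨ε, hε, hcol⟩ := hA.exists_sign hB h3 hB2 hv hG hq ⟨a, ha⟩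
  have hprod : ∀ x y, B x p * B y p = A x q * A y q := by
    intro x y
    rw [hcol, hcol]
    rcases hε with rfl | rfl <;> ring
  obtain ⟨x₀, hx₀⟩ := hB.nonempty a
  obtain ⟨s, hs, hx₀s, hsa⟩ := hA.exists_child_subset hB h3 hB2 hv hG hq ha hx₀
  have hzero : ∀ x ∈ vSet A s, ∀ y ∈ vSet B a, y ∉ vSet A s → subtreeGram B a x y = 0 := by
    intro x hx y hy hys
    have h := hG x (hs.1.subset hx) y (hv ▸ ha.1.subset hy)
    rw [hB.subtreeGram_child ha (hsa hx), hA.subtreeGram_across hs hx hys, hprod] at h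
    linarith
  refine ⟨s, hs, subset_antisymm (fun y hy => ?_) hsa, fun x hx y hy => ?_⟩
  · by_contra hys
    have hmul : ∀ x ∈ vSet A s, ∀ y ∈ vSet B a, y ∉ vSet A s →
        subtreeGram B a x y ≠ B x a * B y a := by
      intro x hx y hy hys h
      rw [hzero x hx y hy hys] at h
      exact mul_ne_zero (show B x a ≠ 0 from hsa hx) (show B y a ≠ 0 from hy) h.symm
    by_cases hleaf : children B a = ∅
    · exact hmul x₀ hx₀s y hy hys (hB.subtreeGram_leaf hleaf x₀ y)
    obtain ⟨c₀, hc₀⟩ := Set.nonempty_iff_ne_empty.2 hleaf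
    obtain ⟨c, hc, hx₀c⟩ := hB.exists_child_mem hc₀ hx₀
    have hyc : y ∈ vSet B c := by
      by_contra hyc
      exact hmul x₀ hx₀s y hy hys (hB.subtreeGram_across hc hx₀c hyc)
    obtain ⟨c', hc', hne⟩ := hB.exists_sibling hc
    obtain ⟨z, hz⟩ := hB.nonempty c'
    have hdisj : ∀ u ∈ vSet B c, u ∉ vSet B c' := fun u hu hu' =>
      hne (hB.child_unique hc' hc hu' hu)
    by_cases hzs : z ∈ vSet A s
    · exact hmul z hzs y hy hys (hB.subtreeGram_across hc' hz (hdisj y hyc))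
    · exact hmul x₀ hx₀s z (hc'.1.subset hz) hzs
        (hB.subtreeGram_across hc hx₀c fun h => hdisj z h hz)
  · have h := hG x (hs.1.subset hx) y (hs.1.subset hy)
    rw [hB.subtreeGram_child ha (hsa hx), hA.subtreeGram_child hs hx, hprod] at h
    linarith

/-- Equal kernels on equal blocks force equal columns, up to sign and relabelling. -/
theorem exists_matching (hA : IsHierarchical A) (hB : IsHierarchical B) (h3 : Cond3 A)
    (hB2 : ∀ k, ∀ x ∈ vSet B k, ∃ z ∈ vSet B k, z ≠ x) {p q : Fin K} (hv : vSet B p = vSet A q)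
    (hG : ∀ x ∈ vSet A q, ∀ y ∈ vSet A q, subtreeGram B p x y = subtreeGram A q x y)
    {d : Fin K} (hd : vSet B d ⊆ vSet B p) :
    ∃ e, ∃ ε : ℝ, (ε = 1 ∨ ε = -1) ∧ ∀ x, B x d = ε * A x e := by
  induction hn : K - p.val using Nat.strong_induction_on generalizing p q with
  | _ n ih =>
    by_cases hq : children A q = ∅
    · have hp := hA.children_eq_empty hB hv hG hq
      have hdp : d = p := by
        by_contra hne
        obtain ⟨c, hc, -⟩ :=
          exists_child_of_ssubset (hd.ssubset_of_ne fun h => hne (hB.vSet_injective h))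
        simp [hp] at hc
      subst hdp
      have hprod : ∀ x ∈ vSet A q, ∀ y ∈ vSet A q, B x d * B y d = A x q * A y q := by
        intro x hx y hy
        rw [← hB.subtreeGram_leaf hp, hG x hx y hy, hA.subtreeGram_leaf hq]
      obtain ⟨x₀, hx₀⟩ := hA.nonempty q
      have hx₀A : A x₀ q ≠ 0 := hx₀
      have hx₀B : B x₀ d ≠ 0 := show x₀ ∈ vSet B d from hv ▸ hx₀
      rcases mul_self_eq_mul_self_iff.1 (hprod x₀ hx₀ x₀ hx₀) with h | h
      · refine ⟨q, 1, Or.inl rfl, fun x => ?_⟩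
        by_cases hx : x ∈ vSet A q
        · have := hprod x₀ hx₀ x hx
          rw [h] at this
          rw [mul_left_cancel₀ hx₀A this, one_mul]
        · have hx' : x ∉ vSet B d := hv ▸ hx
          simp only [vSet, Set.mem_ofPred_eq, not_not] at hx hx'
          simp [hx, hx']
      · refine ⟨q, -1, Or.inr rfl, fun x => ?_⟩
        by_cases hx : x ∈ vSet A q
        · have := hprod x₀ hx₀ x hx
          rw [h] at this
          refine mul_left_cancel₀ hx₀A ?_
          linarith
        · have hx' : x ∉ vSet B d := hv ▸ hx
          simp only [vSet, Set.mem_ofPred_eq, not_not] at hx hx'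
          simp [hx, hx']
    · have hqn := Set.nonempty_iff_ne_empty.2 hq
      have hpn : (children B p).Nonempty := by
        rw [Set.nonempty_iff_ne_empty]
        refine fun h => hq (hB.children_eq_empty hA hv.symm (fun x hx y hy => ?_) h)
        rw [hv] at hx hy
        exact (hG x hx y hy).symm
      by_cases hdp : d = p
      · subst hdp
        exact ⟨q, hA.exists_sign hB h3 hB2 hv hG hqn hpn⟩
      · obtain ⟨a, ha, hda⟩ :=
          exists_child_of_ssubset (hd.ssubset_of_ne fun h => hdp (hB.vSet_injective h))
        obtain ⟨s, -, hvs, hGs⟩ := hA.exists_child_eq hB h3 hB2 hv hG hqn ha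
        have hlt : p.val < a.val := hB.lt_of_ssubset ha.1
        exact ih (K - a.val) (by omega) hvs hGs hda rfl

lemma exists_parent [NeZero K] (hA : IsHierarchical A) (h1 : C1 A) {k : Fin K} (hk : k ≠ 0) :
    ∃ p, IsChild A p k := by
  have h0 : vSet A k ⊂ vSet A 0 := by
    refine Set.ssubset_iff_subset_ne.2 ⟨?_, fun h => hk (hA.vSet_injective h)⟩
    rw [h1]
    exact Set.subset_univ _
  obtain ⟨p, hp, hmin⟩ := (Set.toFinite {p | vSet A k ⊂ vSet A p}).exists_minimalFor
    (vSet A) _ ⟨0, h0⟩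
  refine ⟨p, hp, ?_⟩
  rintro ⟨k', h1, h2⟩
  exact h2.not_subset (hmin (j := k') h1 h2.subset)

/-- The labelling rules determine the labels from the family of loading sets. -/
lemma relabelling_eq_id [NeZero K] (hA : IsHierarchical A) (hB : IsHierarchical B) (hA1 : C1 A)
    (hB1 : C1 B) {σ : Fin K → Fin K} (hσ : ∀ k, vSet B k = vSet A (σ k)) : σ = id := by
  have hinj : Function.Injective σ := fun k l h =>
    hB.vSet_injective (by rw [hσ, hσ, h])
  have hsurj := Finite.surjective_of_injective hinj
  have hchild : ∀ {p k}, IsChild B p k → IsChild A (σ p) (σ k) := by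
    rintro p k ⟨h1, h2⟩
    refine ⟨by rwa [← hσ, ← hσ], ?_⟩
    rintro ⟨m, hm1, hm2⟩
    obtain ⟨k', rfl⟩ := hsurj m
    rw [← hσ, ← hσ] at hm1 hm2
    exact h2 ⟨k', hm1, hm2⟩
  have hmono : ∀ l k : Fin K, k < l → σ k < σ l := by
    intro l
    induction l using WellFoundedLT.induction with
    | _ l ih =>
      intro k hkl
      have hl : l ≠ 0 := (lt_of_le_of_lt (Fin.zero_le k) hkl).ne'
      by_cases hk : k = 0
      · subst hk
        have h0 : σ 0 = 0 := hA.vSet_injective (by rw [← hσ, hA1, hB1])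
        rw [h0]
        refine lt_of_le_of_ne (Fin.zero_le _) fun h => hl (hinj ?_)
        rw [h0, ← h]
      obtain ⟨p, hp⟩ := hB.exists_parent hB1 hk
      obtain ⟨r, hr⟩ := hB.exists_parent hB1 hl
      rcases lt_trichotomy p r with hpr | rfl | hpr
      · have h := ih r (hB.lt_of_ssubset hr.1) p hpr
        exact hA.c3.2.2.2 _ _ _ _ (hchild hp) (hchild hr) h.ne h
      · obtain ⟨x, hx, hxmin⟩ := (vSet B k).exists_min_image id (Set.toFinite _) (hB.nonempty k)
        obtain ⟨y, hy, hymin⟩ := (vSet B l).exists_min_image id (Set.toFinite _) (hB.nonempty l)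
        rcases lt_trichotomy x y with hxy | rfl | hxy
        · refine hA.c3.2.2.1 _ _ _ (hchild hp) (hchild hr) ⟨x, hσ k ▸ hx, fun j hj => ?_⟩
          rw [← hσ] at hj
          exact hxy.trans_le (hymin j hj)
        · exact absurd (hB.child_unique hp hr hx hy) hkl.ne
        · exact absurd (hB.c3.2.2.1 _ _ _ hr hp ⟨y, hy, fun j hj => hxy.trans_le (hxmin j hj)⟩)
            hkl.not_gt
      · exact absurd (hB.c3.2.2.2 _ _ _ _ hr hp hpr.ne hpr) hkl.not_gt
  have hσmono : StrictMono σ := fun k l h => hmono l k h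
  refine (hσmono.range_inj strictMono_id).1 ?_
  rw [hsurj.range_eq, Set.range_id]

end IsHierarchical
end Hierarchy

/-- **Theorem 1 (identifiability of the hierarchical factor model).** -/
theorem identifiability_hierarchical_factor_model {J K : ℕ} [NeZero K]
    (Λstar : Matrix (Fin J) (Fin K) ℝ) (Ψstar : Matrix (Fin J) (Fin J) ℝ)
    -- Condition 1: Λ* has rank K and follows a hierarchical factor structure (C1–C3),
    -- Ψ* is diagonal with positive diagonal entries
    (hrank : Λstar.rank = K)
    (hC1 : C1 Λstar) (hC2 : C2 Λstar) (hC3 : C3 Λstar)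
    (hΨstarDiag : Ψstar.IsDiag) (hΨstarPos : ∀ j, 0 < Ψstar j j)
    -- Condition 2: separation of the low-rank and diagonal parts
    (hsep : ∀ (Λ' : Matrix (Fin J) (Fin K) ℝ) (Ψ' : Matrix (Fin J) (Fin J) ℝ),
      Ψ'.IsDiag → Λstar * Λstarᵀ + Ψstar = Λ' * Λ'ᵀ + Ψ' →
      Λ' * Λ'ᵀ = Λstar * Λstarᵀ ∧ Ψ' = Ψstar)
    -- Condition 3: the rank condition on Λ*
    (hcond3 : Cond3 Λstar) :
    ∀ (Λ : Matrix (Fin J) (Fin K) ℝ) (Ψ : Matrix (Fin J) (Fin J) ℝ),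
      C1 Λ → C2 Λ → C3 Λ → C4 Λ →
      Ψ.IsDiag → (∀ j, 0 < Ψ j j) →
      Λ * Λᵀ + Ψ = Λstar * Λstarᵀ + Ψstar →
      ∃ Q : Matrix (Fin K) (Fin K) ℝ, Q.IsDiag ∧ (∀ k, Q k k = 1 ∨ Q k k = -1) ∧
        Λ = Λstar * Q ∧ Ψ = Ψstar := by
  intro Λ Ψ hΛ1 hΛ2 hΛ3 hΛ4 hΨ _ hcov
  obtain ⟨hgram, hΨeq⟩ := hsep Λ Ψ hΨ hcov.symm
  have hli : LinearIndependent ℝ Λstar.col := by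
    rw [linearIndependent_iff_card_eq_finrank_span, Set.finrank, ← rank_eq_finrank_span_cols, hrank,
      Fintype.card_fin]
  have hstar : IsHierarchical Λstar := by
    refine ⟨fun k => ?_, hC2, hC3⟩
    obtain ⟨x, hx⟩ := Function.ne_iff.1 (hli.ne_zero k)
    exact ⟨x, hx⟩
  have hΛ : IsHierarchical Λ := by
    refine ⟨fun k => Set.nonempty_of_ncard_ne_zero ?_, hΛ2, hΛ3⟩
    have := (hΛ4 k).1
    omega
  have hroot : ∀ (A : Matrix (Fin J) (Fin K) ℝ), C1 A → ∀ x y,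
      subtreeGram A 0 x y = (A * Aᵀ) x y := by
    intro A hA x y
    rw [C1] at hA
    simp [subtreeGram, hA, Matrix.mul_apply]
  have hmatch : ∀ k, ∃ e, ∃ ε : ℝ, (ε = 1 ∨ ε = -1) ∧ ∀ x, Λ x k = ε * Λstar x e := fun k =>
    hstar.exists_matching hΛ hcond3
      (fun k x _ => Set.exists_ne_of_one_lt_ncard (by have := (hΛ4 k).1; omega) x)
      (hΛ1.trans hC1.symm)
      (fun x _ y _ => by rw [hroot Λ hΛ1, hroot Λstar hC1, hgram])
      (hΛ1.symm ▸ Set.subset_univ (vSet Λ k))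
  choose σ ε hε hcol using hmatch
  have hσ : σ = id := by
    refine hstar.relabelling_eq_id hΛ hC1 hΛ1 fun k => ?_
    ext x
    have hεk : ε k ≠ 0 := by rcases hε k with h | h <;> rw [h] <;> norm_num
    simp [vSet, hcol, hεk]
  subst hσ
  refine ⟨Matrix.diagonal ε, Matrix.isDiag_diagonal ε, by simpa using hε, ?_, hΨeq⟩
  ext x k
  rw [Matrix.mul_diagonal, hcol, mul_comm, id]
end
end

section
/- Deterministic stability of the diagonal part (core of Lemma C.3): Let τ > 0 and let Λ ∈ ℝ^{J×K} have all entries in [−τ, τ] and satisfy: for every j ∈ {1,…,J} there exist disjoint sets E1, E2 ⊆ {1,…,J}∖{j}, each of cardinality K, such that the K×K row-submatrices Λ_[E1,·] and Λ_[E2,·] are invertible. Then there exists a constant C > 0, depending only on Λ, τ, K and J, such that for every Λ' ∈ ℝ^{J×K} with all entries in [−τ, τ] and all J×J diagonal matrices Ψ, Ψ': ‖Ψ' − Ψ‖_F ≤ C‖Λ'(Λ')ᵀ + Ψ' − ΛΛᵀ − Ψ‖_F, and consequently ‖Λ'(Λ')ᵀ − ΛΛᵀ‖_F ≤ (1 +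 C)‖Λ'(Λ')ᵀ + Ψ' − ΛΛᵀ − Ψ‖_F. -/
open Matrix Set

noncomputable section

/-- Frobenius norm of a real matrix. -/
def frobNorm {m n : Type*} [Fintype m] [Fintype n] (A : Matrix m n ℝ) : ℝ :=
  Real.sqrt (∑ i, ∑ j, (A i j) ^ 2)

/-- Full column rank of the submatrix of `Λ` with rows in `S` (all columns retained),
i.e. its columns are linearly independent. -/
def FullColRankRows {J K : ℕ} (Λ : Matrix (Fin J) (Fin K) ℝ) (S : Set (Fin J)) : Prop :=
  LinearIndependent ℝ (fun c : Fin K => fun r : S => Λ r.1 c)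

/-- A family of `K` rows with full column rank can be enumerated injectively by `Fin K`, giving
an invertible square submatrix. -/
lemma FullColRankRows.exists_enum {J K : ℕ} {Λ : Matrix (Fin J) (Fin K) ℝ} {S : Set (Fin J)}
    (hcard : S.ncard = K) (h : FullColRankRows Λ S) :
    ∃ f : Fin K → Fin J, (∀ k, f k ∈ S) ∧ (Λ.submatrix f id).det ≠ 0 := by
  have hc : Nat.card S = K := hcard
  let e : S ≃ Fin K := Finite.equivFinOfCardEq hc
  refine ⟨fun k => (e.symm k).1, fun k => (e.symm k).2, ?_⟩
  have h2 := h.map' (LinearMap.funLeft ℝ ℝ e.symm) (LinearMap.ker_eq_bot.2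
    (LinearMap.funLeft_injective_of_surjective _ _ _ e.symm.surjective))
  have h3 : LinearIndependent ℝ (Λ.submatrix (fun k => (e.symm k).1) id).col := h2
  rw [Matrix.linearIndependent_cols_iff_isUnit, Matrix.isUnit_iff_isUnit_det] at h3
  exact h3.ne_zero

/-- Entries of the adjugate of a matrix with bounded entries are bounded. -/
lemma abs_adjugate_apply_le {n : Type*} [Fintype n] [DecidableEq n] {τ : ℝ} {A : Matrix n n ℝ}
    (hA : ∀ i j, |A i j| ≤ τ) (i j : n) :
    |A.adjugate i j| ≤ (Fintype.card n).factorial * (max τ 1) ^ Fintype.card n := by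
  rw [Matrix.adjugate_apply]
  have := Matrix.det_le (A := A.updateRow j (Pi.single i 1)) (abv := AbsoluteValue.abs)
    (x := max τ 1) (fun k l => by
      rw [Matrix.updateRow_apply]
      split_ifs
      · rcases eq_or_ne l i with rfl | h
        · simp
        · simp [h]
      · exact (hA k l).trans (le_max_left _ _))
  simpa [nsmul_eq_mul] using this

/-- Quantitative injectivity: the determinant times a vector is controlled by its image. -/
lemma abs_det_mul_apply_le {n : Type*} [Fintype n] [DecidableEq n] {τ s : ℝ} {A : Matrix n n ℝ}
    (hA : ∀ i j, |A i j| ≤ τ) {u : n → ℝ} (hu : ∀ i, |(A *ᵥ u) i| ≤ s) (c : n) :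
    |A.det * u c| ≤ Fintype.card n *
      (((Fintype.card n).factorial * (max τ 1) ^ Fintype.card n) * s) := by
  have h : A.det * u c = ∑ i, A.adjugate c i * (A *ᵥ u) i := by
    have := congrFun (Matrix.mulVec_mulVec u A.adjugate A) c
    rw [Matrix.adjugate_mul, Matrix.smul_mulVec, Matrix.one_mulVec] at this
    simpa [Matrix.mulVec, dotProduct] using this.symm
  rw [h]
  refine (Finset.abs_sum_le_sum_abs _ _).trans ?_
  refine (Finset.sum_le_card_nsmul _ _ _ fun i _ => ?_).trans_eq (nsmul_eq_mul _ _)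
  rw [abs_mul]
  exact mul_le_mul (abs_adjugate_apply_le hA c i) (hu i) (abs_nonneg _) (by positivity)

/-- The determinant stays away from zero near an invertible matrix. -/
lemma exists_half_abs_det_le {n : Type*} [Fintype n] [DecidableEq n] {A : Matrix n n ℝ}
    (hA : A.det ≠ 0) :
    ∃ ε > 0, ∀ B : Matrix n n ℝ, (∀ i j, |B i j - A i j| < ε) → |A.det| / 2 ≤ |B.det| := by
  have hc : Continuous fun B : n → n → ℝ => |Matrix.det (Matrix.of B)| :=
    (Continuous.matrix_det continuous_id).abs
  have hA' : |A.det| / 2 < |A.det| := half_lt_self (abs_pos.2 hA)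
  obtain ⟨ε, hε, h⟩ := Metric.eventually_nhds_iff.1
    ((hc.tendsto fun i j => A i j).eventually (lt_mem_nhds hA'))
  refine ⟨ε, hε, fun B hB => (h (y := fun i j => B i j) ?_).le⟩
  rw [dist_pi_lt_iff hε]
  intro i
  rw [dist_pi_lt_iff hε]
  exact fun j => hB i j

lemma abs_gram_apply_le {m n : Type*} [Fintype n] {τ : ℝ} {M : Matrix m n ℝ}
    (hM : ∀ i j, |M i j| ≤ τ) (i j : m) : |(M * Mᵀ) i j| ≤ Fintype.card n * (τ * τ) := by
  rw [Matrix.mul_apply]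
  refine (Finset.abs_sum_le_sum_abs _ _).trans ?_
  refine (Finset.sum_le_card_nsmul _ _ _ fun c _ => ?_).trans_eq (nsmul_eq_mul _ _)
  rw [abs_mul]
  exact mul_le_mul (hM i c) (hM j c) (abs_nonneg _) ((abs_nonneg _).trans (hM i c))

lemma sum_mul_sub_eq_gram {m n p : Type*} [Fintype n] [Fintype p] (M : Matrix m n ℝ) (f : p → m)
    (x : p → ℝ) (i j : m) :
    ∑ c, M i c * (M j c - ∑ k, x k * M (f k) c) =
      (M * Mᵀ) i j - ∑ k, x k * (M * Mᵀ) i (f k) := by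
  simp only [Matrix.mul_apply, Matrix.transpose_apply, mul_sub, Finset.sum_sub_distrib,
    Finset.mul_sum]
  rw [Finset.sum_comm]
  simp only [mul_left_comm]

/-- If the Gram matrices of two bounded matrices are close off the diagonal, and the first has two
invertible square blocks of rows, disjoint from each other and avoiding `j`, then their `j`-th
diagonal entries are close. -/
lemma exists_abs_gram_diag_sub_le {m n : Type*} [Fintype n] [DecidableEq n] {τ : ℝ} (hτ : 0 ≤ τ)
    {Λ : Matrix m n ℝ} {j : m} {f g : n → m} (hfg : ∀ k l, f k ≠ g l) (hf : ∀ k, f k ≠ j)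
    (hg : ∀ k, g k ≠ j) (hA : (Λ.submatrix f id).det ≠ 0) (hB : (Λ.submatrix g id).det ≠ 0)
    (hΛ : ∀ i k, |Λ i k| ≤ τ) :
    ∃ C : ℝ, 0 ≤ C ∧ ∀ Λ' : Matrix m n ℝ, (∀ i k, |Λ' i k| ≤ τ) → ∀ r : ℝ, 0 ≤ r →
      (∀ i k, i ≠ k → |(Λ' * Λ'ᵀ) i k - (Λ * Λᵀ) i k| ≤ r) →
      |(Λ' * Λ'ᵀ) j j - (Λ * Λᵀ) j j| ≤ C * r := by
  set A := Λ.submatrix f id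
  set B := Λ.submatrix g id
  obtain ⟨x, hx⟩ : ∃ x : n → ℝ, ∀ c, Λ j c = ∑ k, x k * Λ (f k) c := by
    refine ⟨Λ j ᵥ* A⁻¹, fun c => ?_⟩
    have h : (Λ j ᵥ* A⁻¹) ᵥ* A = Λ j := by
      rw [Matrix.vecMul_vecMul, Matrix.nonsing_inv_mul _ (isUnit_iff_ne_zero.2 hA),
        Matrix.vecMul_one]
    exact (congrFun h c).symm
  set X := ∑ k, |x k|
  have hX : 0 ≤ X := Finset.sum_nonneg fun _ _ => abs_nonneg _
  have hAB : (A * Bᵀ).det ≠ 0 := by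
    rw [Matrix.det_mul, Matrix.det_transpose]
    exact mul_ne_zero hA hB
  obtain ⟨ε, hε, hdet⟩ := exists_half_abs_det_le hAB
  set δ := |(A * Bᵀ).det| / 2
  have hδ : 0 < δ := half_pos (abs_pos.2 hAB)
  set N : ℝ := (Fintype.card n : ℝ)
  have hN0 : 0 ≤ N := Nat.cast_nonneg _
  set D : ℝ := (Fintype.card n).factorial * (max τ 1) ^ Fintype.card n
  have hD0 : 0 ≤ D := by positivity
  set Q : ℝ := D * (N * (D * (1 + X))) / δ
  have hQ : 0 ≤ Q := by positivity
  refine ⟨N * (τ * Q) + X + 2 * (N * (τ * τ)) / ε, by positivity, fun Λ' hΛ' r hr hoff => ?_⟩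
  set u : n → ℝ := fun c => Λ' j c - ∑ k, x k * Λ' (f k) c with hu
  have hrow : ∀ i, (∀ k, i ≠ f k) →
      |∑ c, Λ' i c * u c - ((Λ' * Λ'ᵀ) i j - (Λ * Λᵀ) i j)| ≤ X * r := by
    intro i hi
    have h0 := sum_mul_sub_eq_gram Λ f x i j
    simp only [← hx, sub_self, mul_zero, Finset.sum_const_zero] at h0
    have h : ∑ c, Λ' i c * u c - ((Λ' * Λ'ᵀ) i j - (Λ * Λᵀ) i j) =
        -∑ k, x k * ((Λ' * Λ'ᵀ) i (f k) - (Λ * Λᵀ) i (f k)) := by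
      rw [hu, sum_mul_sub_eq_gram Λ' f x i j]
      simp only [mul_sub, Finset.sum_sub_distrib]
      linarith
    rw [h, abs_neg, Finset.sum_mul]
    refine (Finset.abs_sum_le_sum_abs _ _).trans (Finset.sum_le_sum fun k _ => ?_)
    rw [abs_mul]
    exact mul_le_mul_of_nonneg_left (hoff _ _ (hi k)) (abs_nonneg _)
  rcases lt_or_ge r ε with hlt | hge
  · have hδ' : δ ≤ |(Λ'.submatrix f id).det * (Λ'.submatrix g id).det| := by
      rw [← Matrix.det_transpose (Λ'.submatrix g id), ← Matrix.det_mul]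
      exact hdet _ fun k l => (hoff (f k) (g l) (hfg k l)).trans_lt hlt
    have hBu : ∀ l, |(Λ'.submatrix g id *ᵥ u) l| ≤ (1 + X) * r := by
      intro l
      have h1 := hrow (g l) fun k => (hfg k l).symm
      have h2 := hoff (g l) j (hg l)
      have h3 : (Λ'.submatrix g id *ᵥ u) l = ∑ c, Λ' (g l) c * u c := rfl
      rw [h3]
      rw [abs_le] at *
      constructor <;> linarith
    have hdetA : |(Λ'.submatrix f id).det| ≤ D := by
      have h := Matrix.det_le (A := Λ'.submatrix f id) (abv := AbsoluteValue.abs)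
        (x := max τ 1) (fun k l => (hΛ' _ _).trans (le_max_left _ _))
      simpa [nsmul_eq_mul] using h
    have huc : ∀ c, |u c| ≤ Q * r := by
      intro c
      have h1 := abs_det_mul_apply_le (A := Λ'.submatrix g id) (fun k l => hΛ' _ _) hBu c
      have h2 : δ * |u c| ≤ D * (N * (D * ((1 + X) * r))) :=
        calc δ * |u c| ≤ |(Λ'.submatrix f id).det * (Λ'.submatrix g id).det| * |u c| := by gcongr
          _ = |(Λ'.submatrix f id).det| * |(Λ'.submatrix g id).det * u c| := by
            rw [abs_mul, abs_mul, mul_assoc]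
          _ ≤ _ := mul_le_mul hdetA h1 (abs_nonneg _) hD0
      rw [div_mul_eq_mul_div, le_div_iff₀ hδ]
      linarith
    have hsum : |∑ c, Λ' j c * u c| ≤ N * (τ * (Q * r)) := by
      refine (Finset.abs_sum_le_sum_abs _ _).trans ?_
      refine (Finset.sum_le_card_nsmul _ _ _ fun c _ => ?_).trans_eq (nsmul_eq_mul _ _)
      rw [abs_mul]
      exact mul_le_mul (hΛ' j c) (huc c) (abs_nonneg _) hτ
    have h1 := hrow j fun k => (hf k).symm
    have h2 : 0 ≤ 2 * (N * (τ * τ)) / ε * r := by positivity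
    rw [abs_le] at *
    constructor <;> linarith
  · have h1 := abs_gram_apply_le hΛ' j j
    have h2 := abs_gram_apply_le hΛ j j
    have h3 : 2 * (N * (τ * τ)) ≤ 2 * (N * (τ * τ)) / ε * r := by
      rw [div_mul_eq_mul_div, le_div_iff₀ hε]
      gcongr
    have h4 : 0 ≤ (N * (τ * Q) + X) * r := by positivity
    rw [abs_le] at *
    constructor <;> linarith

lemma frobNorm_nonneg {m n : Type*} [Fintype m] [Fintype n] (A : Matrix m n ℝ) :
    0 ≤ frobNorm A := Real.sqrt_nonneg _

lemma frobNorm_sub_le {m n : Type*} [Fintype m] [Fintype n] (A B : Matrix m n ℝ) :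
    frobNorm (A - B) ≤ frobNorm A + frobNorm B := by
  let _ := Matrix.frobeniusNormedAddCommGroup (m := m) (n := n) (α := ℝ)
  have h (M : Matrix m n ℝ) : frobNorm M = ‖M‖ := by
    rw [Matrix.frobenius_norm_def, frobNorm, Real.sqrt_eq_rpow]
    simp
  simpa only [h] using norm_sub_le A B

lemma abs_apply_le_frobNorm {m n : Type*} [Fintype m] [Fintype n] (A : Matrix m n ℝ) (i : m)
    (j : n) : |A i j| ≤ frobNorm A := by
  refine Real.abs_le_sqrt ?_
  calc A i j ^ 2 ≤ ∑ l, A i l ^ 2 :=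
        Finset.single_le_sum (f := fun l => A i l ^ 2) (fun _ _ => sq_nonneg _)
          (Finset.mem_univ j)
    _ ≤ _ := Finset.single_le_sum (f := fun k => ∑ l, A k l ^ 2)
        (fun _ _ => Finset.sum_nonneg fun _ _ => sq_nonneg _) (Finset.mem_univ i)

lemma Matrix.IsDiag.frobNorm_le {n : Type*} [Fintype n] {A : Matrix n n ℝ}
    (hA : A.IsDiag) : frobNorm A ≤ ∑ i, |A i i| := by
  refine Real.sqrt_le_iff.2 ⟨Finset.sum_nonneg fun _ _ => abs_nonneg _, ?_⟩
  calc ∑ i, ∑ j, A i j ^ 2 = ∑ i, |A i i| ^ 2 := by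
        refine Finset.sum_congr rfl fun i _ => ?_
        rw [Finset.sum_eq_single i (fun j _ hj => by rw [hA hj.symm]; simp) (by simp), sq_abs]
    _ ≤ _ := Finset.sum_sq_le_sq_sum_of_nonneg fun _ _ => abs_nonneg _

/-- **Deterministic stability of the diagonal part (core of Lemma C.3).**
If every variable `j` can be removed while leaving two disjoint sets of `K` rows on each of
which `Λ` is invertible, then the diagonal part of the decomposition `ΛΛᵀ + Ψ` is stable in
Frobenius norm, uniformly over loading matrices with entries bounded by `τ`. -/
theorem deterministic_stability_diagonal_part {J K : ℕ} (τ : ℝ) (hτ : 0 < τ)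
    (Λ : Matrix (Fin J) (Fin K) ℝ)
    (hΛτ : ∀ i j, |Λ i j| ≤ τ)
    (hcond : ∀ j : Fin J, ∃ E1 E2 : Set (Fin J),
      E1 ⊆ {j}ᶜ ∧ E2 ⊆ {j}ᶜ ∧ Disjoint E1 E2 ∧
      E1.ncard = K ∧ E2.ncard = K ∧
      FullColRankRows Λ E1 ∧ FullColRankRows Λ E2) :
    ∃ C : ℝ, 0 < C ∧
      ∀ (Λ' : Matrix (Fin J) (Fin K) ℝ), (∀ i j, |Λ' i j| ≤ τ) →
      ∀ (Ψ Ψ' : Matrix (Fin J) (Fin J) ℝ), Ψ.IsDiag → Ψ'.IsDiag →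
        frobNorm (Ψ' - Ψ) ≤ C * frobNorm (Λ' * Λ'ᵀ + Ψ' - (Λ * Λᵀ + Ψ)) ∧
        frobNorm (Λ' * Λ'ᵀ - Λ * Λᵀ) ≤
          (1 + C) * frobNorm (Λ' * Λ'ᵀ + Ψ' - (Λ * Λᵀ + Ψ)) := by
  have key : ∀ j : Fin J, ∃ C : ℝ, 0 ≤ C ∧ ∀ Λ' : Matrix (Fin J) (Fin K) ℝ,
      (∀ i k, |Λ' i k| ≤ τ) → ∀ r : ℝ, 0 ≤ r →
      (∀ i k, i ≠ k → |(Λ' * Λ'ᵀ) i k - (Λ * Λᵀ) i k| ≤ r) →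
      |(Λ' * Λ'ᵀ) j j - (Λ * Λᵀ) j j| ≤ C * r := by
    intro j
    obtain ⟨E1, E2, h1, h2, hdisj, hc1, hc2, hr1, hr2⟩ := hcond j
    obtain ⟨f, hf, hA⟩ := hr1.exists_enum hc1
    obtain ⟨g, hg, hB⟩ := hr2.exists_enum hc2
    exact exists_abs_gram_diag_sub_le hτ.le (fun k l => hdisj.ne_of_mem (hf k) (hg l))
      (fun k => h1 (hf k)) (fun k => h2 (hg k)) hA hB hΛτ
  choose C hC0 hC using key
  have hS : 0 ≤ ∑ j, (C j + 1) := Finset.sum_nonneg fun j _ => by linarith [hC0 j]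
  refine ⟨1 + ∑ j, (C j + 1), by positivity, fun Λ' hΛ' Ψ Ψ' hΨ hΨ' => ?_⟩
  set R := Λ' * Λ'ᵀ + Ψ' - (Λ * Λᵀ + Ψ) with hR
  have hR0 := frobNorm_nonneg R
  have hRapp (i k) : R i k = (Λ' * Λ'ᵀ) i k + Ψ' i k - ((Λ * Λᵀ) i k + Ψ i k) := rfl
  have hoff : ∀ i k, i ≠ k → |(Λ' * Λ'ᵀ) i k - (Λ * Λᵀ) i k| ≤ frobNorm R := by
    intro i k hik
    have h := abs_apply_le_frobNorm R i k
    rwa [hRapp, hΨ hik, hΨ' hik, add_zero, add_zero] at h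
  have hdiag : frobNorm (Ψ' - Ψ) ≤ (1 + ∑ j, (C j + 1)) * frobNorm R := by
    refine (hΨ'.sub hΨ).frobNorm_le.trans ?_
    calc ∑ j, |(Ψ' - Ψ) j j| ≤ ∑ j, (C j + 1) * frobNorm R := by
          refine Finset.sum_le_sum fun j _ => ?_
          have h1 := hC j Λ' hΛ' _ hR0 hoff
          have h2 := abs_apply_le_frobNorm R j j
          rw [hRapp] at h2
          rw [Matrix.sub_apply]
          rw [abs_le] at *
          constructor <;> linarith
      _ = (∑ j, (C j + 1)) * frobNorm R := (Finset.sum_mul _ _ _).symm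
      _ ≤ _ := by
          gcongr
          linarith
  refine ⟨hdiag, ?_⟩
  have h : Λ' * Λ'ᵀ - Λ * Λᵀ = R - (Ψ' - Ψ) := by
    rw [hR]
    abel
  rw [h]
  linarith [frobNorm_sub_le R (Ψ' - Ψ)]
end
end

section
/- Exact uniqueness of the decomposition under the double full-rank condition (Condition 4 implies Condition 2): Let Λ* ∈ ℝ^{J×K} be such that for every j ∈ {1,…,J} there exist disjoint sets E1, E2 ⊆ {1,…,J}∖{j}, each of cardinality K, with the K×K row-submatrices Λ*_[E1,·] and Λ*_[E2,·] invertible. Then for every Λ ∈ ℝ^{J×K} and all J×J diagonal matrices Ψ, Ψ* satisfying ΛΛᵀ + Ψ = Λ*(Λ*)ᵀ + Ψ*, one has Ψ = Ψ* and ΛΛᵀ = Λ*(Λ*)ᵀ. -/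
open Matrix Set

noncomputable section

/-- A set of `K` rows of full column rank gives an invertible `K × K` row-submatrix. -/
theorem FullColRankRows.exists_isUnit_submatrix {J K : ℕ} {Λ : Matrix (Fin J) (Fin K) ℝ}
    {E : Set (Fin J)} (hE : FullColRankRows Λ E) (hcard : E.ncard = K) :
    ∃ f : Fin K → Fin J, (∀ k, f k ∈ E) ∧ IsUnit (Λ.submatrix f id) := by
  let e : Fin K ≃ E := (Finite.equivFinOfCardEq hcard).symm
  refine ⟨fun k => e k, fun k => (e k).2, ?_⟩
  rw [← Matrix.linearIndependent_cols_iff_isUnit]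
  exact hE.map' (LinearEquiv.funCongrLeft ℝ ℝ e).toLinearMap (LinearEquiv.ker _)

/-- If two Gram matrices agree off the diagonal, and one of them has two invertible square blocks of
rows that avoid `j` and each other, then they agree at the diagonal entry `j`. -/
theorem dotProduct_self_eq_of_isUnit_submatrix {ι κ R : Type*} [Fintype κ] [DecidableEq κ]
    [CommRing R] {A B : Matrix ι κ R}
    (h : ∀ i k, i ≠ k → A i ⬝ᵥ A k = B i ⬝ᵥ B k) {j : ι} {f g : κ → ι}
    (hf : ∀ a, f a ≠ j) (hg : ∀ a, g a ≠ j) (hfg : ∀ a b, f a ≠ g b)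
    (hF : IsUnit (B.submatrix f id)) (hG : IsUnit (B.submatrix g id)) :
    A j ⬝ᵥ A j = B j ⬝ᵥ B j := by
  have hblock : A.submatrix g id * (A.submatrix f id)ᵀ =
      B.submatrix g id * (B.submatrix f id)ᵀ := by
    ext a b
    exact h _ _ (hfg b a).symm
  have hfj : A.submatrix f id *ᵥ A j = B.submatrix f id *ᵥ B j := funext fun a => h _ _ (hf a)
  have hgj : A.submatrix g id *ᵥ A j = B.submatrix g id *ᵥ B j := funext fun a => h _ _ (hg a)
  have hGA : IsUnit (A.submatrix g id) := by
    have hu : IsUnit (A.submatrix g id * (A.submatrix f id)ᵀ) := by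
      rw [hblock]
      exact hG.mul ((Matrix.isUnit_transpose _).2 hF)
    rw [Matrix.isUnit_iff_isUnit_det, Matrix.det_mul] at hu
    exact (Matrix.isUnit_iff_isUnit_det _).2 (isUnit_of_mul_isUnit_left hu)
  obtain ⟨a, ha⟩ : ∃ a, (B.submatrix f id)ᵀ *ᵥ a = B j :=
    Matrix.mulVec_surjective_iff_isUnit.2 ((Matrix.isUnit_transpose _).2 hF) (B j)
  have haA : (A.submatrix f id)ᵀ *ᵥ a = A j := by
    apply Matrix.mulVec_injective_of_isUnit hGA
    rw [hgj, Matrix.mulVec_mulVec, hblock, ← Matrix.mulVec_mulVec, ha]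
  calc A j ⬝ᵥ A j = (A.submatrix f id *ᵥ A j) ⬝ᵥ a := by
        rw [← Matrix.vecMul_transpose, ← Matrix.dotProduct_mulVec, haA]
    _ = B j ⬝ᵥ B j := by
        rw [hfj, ← Matrix.vecMul_transpose, ← Matrix.dotProduct_mulVec, ha]

/-- **Exact uniqueness of the decomposition under the double full-rank condition**
(Condition 4 implies Condition 2). -/
theorem uniqueness_decomposition_double_full_rank {J K : ℕ}
    (Λstar : Matrix (Fin J) (Fin K) ℝ)
    (hcond : ∀ j : Fin J, ∃ E1 E2 : Set (Fin J),
      E1 ⊆ {j}ᶜ ∧ E2 ⊆ {j}ᶜ ∧ Disjoint E1 E2 ∧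
      E1.ncard = K ∧ E2.ncard = K ∧
      FullColRankRows Λstar E1 ∧ FullColRankRows Λstar E2) :
    ∀ (Λ : Matrix (Fin J) (Fin K) ℝ) (Ψ Ψstar : Matrix (Fin J) (Fin J) ℝ),
      Ψ.IsDiag → Ψstar.IsDiag →
      Λ * Λᵀ + Ψ = Λstar * Λstarᵀ + Ψstar →
      Ψ = Ψstar ∧ Λ * Λᵀ = Λstar * Λstarᵀ := by
  intro Λ Ψ Ψstar hΨ hΨstar heq
  have hoff : ∀ i k, i ≠ k → Λ i ⬝ᵥ Λ k = Λstar i ⬝ᵥ Λstar k := by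
    intro i k hik
    have hentry := congrFun (congrFun heq i) k
    rwa [Matrix.add_apply, Matrix.add_apply, hΨ hik, hΨstar hik, add_zero, add_zero] at hentry
  have hgram : Λ * Λᵀ = Λstar * Λstarᵀ := by
    ext i k
    rcases eq_or_ne i k with rfl | hik
    · obtain ⟨E1, E2, hE1, hE2, hdisj, hc1, hc2, hr1, hr2⟩ := hcond i
      obtain ⟨f, hf, hF⟩ := hr1.exists_isUnit_submatrix hc1
      obtain ⟨g, hg, hG⟩ := hr2.exists_isUnit_submatrix hc2
      exact dotProduct_self_eq_of_isUnit_submatrix hoff (fun a => hE1 (hf a))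
        (fun a => hE2 (hg a)) (fun a b => hdisj.ne_of_mem (hf a) (hg b)) hF hG
    · exact hoff i k hik
  refine ⟨?_, hgram⟩
  rw [hgram] at heq
  exact add_left_cancel heq
end
end

section
/- Rank-one direction perturbation bound (the form of Wedin's theorem used repeatedly in the proof of Theorem 2): Let u* ∈ ℝ^m and v* ∈ ℝ^n be nonzero vectors, and let u ∈ ℝ^m be nonzero and v ∈ ℝ^n arbitrary. If ‖uvᵀ − u*(v*)ᵀ‖_F ≤ δ, then min( ‖u/‖u‖ − u*/‖u*‖‖ , ‖u/‖u‖ + u*/‖u*‖‖ ) ≤ 2δ/(‖u*‖·‖v*‖). -/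
open Matrix

noncomputable section

/-- Euclidean norm of a real vector. -/
def eNorm {n : Type*} [Fintype n] (v : n → ℝ) : ℝ :=
  Real.sqrt (∑ i, (v i) ^ 2)

theorem eNorm_nonneg {ι : Type*} [Fintype ι] (x : ι → ℝ) : 0 ≤ eNorm x :=
  Real.sqrt_nonneg _

theorem eNorm_sq {ι : Type*} [Fintype ι] (x : ι → ℝ) : eNorm x ^ 2 = ∑ i, x i ^ 2 :=
  Real.sq_sqrt (Finset.sum_nonneg fun _ _ => sq_nonneg _)

theorem eNorm_pos {ι : Type*} [Fintype ι] {x : ι → ℝ} (hx : x ≠ 0) : 0 < eNorm x := by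
  obtain ⟨i, hi⟩ := Function.ne_iff.mp hx
  exact Real.sqrt_pos.mpr (Finset.sum_pos' (fun _ _ => sq_nonneg _)
    ⟨i, Finset.mem_univ i, sq_pos_of_ne_zero hi⟩)

theorem sum_div_eNorm_sq {ι : Type*} [Fintype ι] {x : ι → ℝ} (hx : x ≠ 0) :
    ∑ i, (x i / eNorm x) ^ 2 = 1 := by
  simp_rw [div_pow]
  rw [← Finset.sum_div, ← eNorm_sq]
  exact div_self (pow_pos (eNorm_pos hx) 2).ne'

theorem sum_mul_sub_mul_sq {ι : Type*} [Fintype ι] (a b : ι → ℝ) (s t : ℝ) :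
    ∑ i, (a i * s - b i * t) ^ 2 =
      s ^ 2 * ∑ i, a i ^ 2 - 2 * s * t * ∑ i, a i * b i + t ^ 2 * ∑ i, b i ^ 2 := by
  simp_rw [Finset.mul_sum]
  rw [← Finset.sum_sub_distrib, ← Finset.sum_add_distrib]
  exact Finset.sum_congr rfl fun i _ => by ring

theorem frobNorm_sq {m n : Type*} [Fintype m] [Fintype n] (A : Matrix m n ℝ) :
    frobNorm A ^ 2 = ∑ i, ∑ j, A i j ^ 2 :=
  Real.sq_sqrt (Finset.sum_nonneg fun _ _ => Finset.sum_nonneg fun _ _ => sq_nonneg _)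

/-- The squared sine of the angle between `u` and `x` is controlled by the distance between the
rank-one matrices `u vᵀ` and `x yᵀ`. -/
theorem sin_sq_le_frobNorm_sq {m n : Type*} [Fintype m] [Fintype n] {u x : m → ℝ}
    (hu : u ≠ 0) (hx : x ≠ 0) (v y : n → ℝ) :
    (eNorm x * eNorm y) ^ 2 * (1 - (∑ i, u i / eNorm u * (x i / eNorm x)) ^ 2) ≤
      frobNorm (Matrix.vecMulVec u v - Matrix.vecMulVec x y) ^ 2 := by
  set c := ∑ i, u i / eNorm u * (x i / eNorm x) with hc
  have hu0 := (eNorm_pos hu).ne'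
  have hx0 := (eNorm_pos hx).ne'
  rw [frobNorm_sq, Finset.sum_comm, mul_pow, eNorm_sq y, Finset.mul_sum, Finset.sum_mul]
  refine Finset.sum_le_sum fun j _ => ?_
  have key := sum_mul_sub_mul_sq (fun i => u i / eNorm u) (fun i => x i / eNorm x)
    (eNorm u * v j) (eNorm x * y j)
  rw [sum_div_eNorm_sq hu, sum_div_eNorm_sq hx, ← hc] at key
  have hentry : ∑ i, (Matrix.vecMulVec u v - Matrix.vecMulVec x y) i j ^ 2 =
      ∑ i, (u i / eNorm u * (eNorm u * v j) - x i / eNorm x * (eNorm x * y j)) ^ 2 := by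
    refine Finset.sum_congr rfl fun i _ => ?_
    rw [Matrix.sub_apply, Matrix.vecMulVec_apply, Matrix.vecMulVec_apply, ← mul_assoc,
      ← mul_assoc, div_mul_cancel₀ _ hu0, div_mul_cancel₀ _ hx0]
  rw [hentry, key]
  linarith [sq_nonneg (eNorm u * v j - c * (eNorm x * y j))]

/-- **Rank-one direction perturbation bound** (the form of Wedin's theorem used
repeatedly in the proof of Theorem 2). -/
theorem rank_one_direction_perturbation {m n : ℕ}
    (ustar : Fin m → ℝ) (vstar : Fin n → ℝ)
    (hustar : ustar ≠ 0) (hvstar : vstar ≠ 0)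
    (u : Fin m → ℝ) (hu : u ≠ 0) (v : Fin n → ℝ)
    (δ : ℝ)
    (h : frobNorm (Matrix.vecMulVec u v - Matrix.vecMulVec ustar vstar) ≤ δ) :
    min (eNorm (fun i => u i / eNorm u - ustar i / eNorm ustar))
        (eNorm (fun i => u i / eNorm u + ustar i / eNorm ustar)) ≤
      2 * δ / (eNorm ustar * eNorm vstar) := by
  have hx := eNorm_pos hustar
  have hy := eNorm_pos hvstar
  have hxy := mul_pos hx hy
  have hδ : 0 ≤ δ := (Real.sqrt_nonneg _).trans h
  have hsin := (sin_sq_le_frobNorm_sq hu hustar v vstar).trans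
    (pow_le_pow_left₀ (Real.sqrt_nonneg _) h 2)
  have hsub := sum_mul_sub_mul_sq (fun i => u i / eNorm u) (fun i => ustar i / eNorm ustar) 1 1
  have hadd := sum_mul_sub_mul_sq (fun i => u i / eNorm u) (fun i => ustar i / eNorm ustar) 1 (-1)
  rw [sum_div_eNorm_sq hu, sum_div_eNorm_sq hustar] at hsub hadd
  simp only [mul_one, mul_neg, sub_neg_eq_add] at hsub hadd
  set c := ∑ i, u i / eNorm u * (ustar i / eNorm ustar)
  rw [← eNorm_sq] at hsub hadd
  have of_sq_le {z : ℝ} (hz : z ^ 2 ≤ 4 * (1 - c ^ 2)) :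
      z ≤ 2 * δ / (eNorm ustar * eNorm vstar) := by
    rw [le_div_iff₀ hxy]
    refine abs_le_of_sq_le_sq' ?_ (by positivity) |>.2
    nlinarith [mul_le_mul_of_nonneg_left hz (sq_nonneg (eNorm ustar * eNorm vstar))]
  have hsub0 := sq_nonneg (eNorm fun i => u i / eNorm u - ustar i / eNorm ustar)
  have hadd0 := sq_nonneg (eNorm fun i => u i / eNorm u + ustar i / eNorm ustar)
  rcases le_total 0 c with hc | hc
  · refine min_le_of_left_le (of_sq_le ?_)
    nlinarith
  · refine min_le_of_right_le (of_sq_le ?_)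
    nlinarith
end
end

section
/- Gram equality with full column rank implies an orthogonal relation (Lemma 5.1 of Anderson and Rubin, used as a key step in the proof of Theorem 1): Let A, B ∈ ℝ^{m×k} satisfy A Aᵀ = B Bᵀ, and suppose B has rank k (full column rank). Then there exists an orthogonal matrix R ∈ ℝ^{k×k} such that A = B R. -/
open Matrix

noncomputable section

/-- A matrix over an ordered field with full column rank has a left inverse. -/
theorem Matrix.exists_left_inverse_of_rank_eq_card {m n K : Type*} [Fintype m] [Fintype n]
    [DecidableEq n] [Field K] [LinearOrder K] [IsStrictOrderedRing K]
    (B : Matrix m n K) (h : B.rank = Fintype.card n) :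
    ∃ L : Matrix n m K, L * B = 1 := by
  have hli : LinearIndependent K (Bᵀ * B).col := by
    rw [linearIndependent_iff_card_eq_finrank_span, Set.finrank,
      ← Matrix.rank_eq_finrank_span_cols, Matrix.rank_transpose_mul_self, h]
  have hu : IsUnit (Bᵀ * B) := Matrix.linearIndependent_cols_iff_isUnit.1 hli
  refine ⟨(Bᵀ * B)⁻¹ * Bᵀ, ?_⟩
  rw [Matrix.mul_assoc, Matrix.nonsing_inv_mul _ ((Matrix.isUnit_iff_isUnit_det _).1 hu)]

/-- **Gram equality with full column rank implies an orthogonal relation**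
(Lemma 5.1 of Anderson and Rubin): if `A Aᵀ = B Bᵀ` and `B` has full column rank `k`,
then `A = B R` for some orthogonal `R`. -/
theorem gram_equality_orthogonal_relation {m k : ℕ}
    (A B : Matrix (Fin m) (Fin k) ℝ)
    (hGram : A * Aᵀ = B * Bᵀ)
    (hrank : B.rank = k) :
    ∃ R : Matrix (Fin k) (Fin k) ℝ, Rᵀ * R = 1 ∧ A = B * R := by
  obtain ⟨L, hL⟩ := B.exists_left_inverse_of_rank_eq_card (by simpa using hrank)
  have hcongr (n : ℕ) (X : Matrix (Fin n) (Fin m) ℝ) :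
      (X * A) * (X * A)ᵀ = (X * B) * (X * B)ᵀ := by
    simp only [transpose_mul, Matrix.mul_assoc]
    rw [← Matrix.mul_assoc A, hGram, Matrix.mul_assoc]
  refine ⟨L * A, ?_, ?_⟩
  · rw [mul_eq_one_comm, hcongr, hL, transpose_one, Matrix.one_mul]
  · have hB : (1 - B * L) * B = 0 := by
      rw [Matrix.sub_mul, Matrix.mul_assoc, hL, Matrix.one_mul, Matrix.mul_one, sub_self]
    have hA : (1 - B * L) * A = 0 := by
      rw [← self_mul_conjTranspose_eq_zero, conjTranspose_eq_transpose_of_trivial, hcongr, hB,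
        Matrix.zero_mul]
    rwa [Matrix.sub_mul, Matrix.one_mul, sub_eq_zero, Matrix.mul_assoc] at hA
end
end

section
/- First-column recovery under orthogonal rotation (exact version of the sign-identification step in the proof of Theorem 2): Let u ∈ ℝ^m be nonzero, let P ∈ ℝ^{m×(K−1)} have full column rank K−1 with Pᵀu = 0, and let α ∈ ℝ^{K−1}. Define B = [u | u αᵀ + P] ∈ ℝ^{m×K} (first column u, remaining K−1 columns u αᵀ + P). If R ∈ ℝ^{K×K} is orthogonal and the first column of BR is a scalar multiple of u, then the first column of R equals e_1 or −e_1; in particular the first column of BR equals u or −u. -/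
open Matrix

noncomputable section

/-- **First-column recovery under orthogonal rotation** (exact version of the
sign-identification step in the proof of Theorem 2).  Here `K = k + 1`, `B = [u | uαᵀ + P]`
with `Pᵀu = 0` and `P` of full column rank; if `R` is orthogonal and the first column of
`BR` is a scalar multiple of `u`, then the first column of `R` is `±e₁` and the first
column of `BR` equals `±u`. -/
theorem first_column_recovery_orthogonal_rotation {m k : ℕ}
    (u : Fin m → ℝ) (hu : u ≠ 0)
    (P : Matrix (Fin m) (Fin k) ℝ)
    (hPrank : LinearIndependent ℝ (fun c : Fin k => fun i : Fin m => P i c))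
    (hPu : ∀ c : Fin k, ∑ i, P i c * u i = 0)
    (α : Fin k → ℝ)
    (B : Matrix (Fin m) (Fin (k + 1)) ℝ)
    (hB : ∀ i, B i = Fin.cons (u i) (fun c : Fin k => u i * α c + P i c))
    (R : Matrix (Fin (k + 1)) (Fin (k + 1)) ℝ)
    (hR : Rᵀ * R = 1)
    (hcol : ∃ t : ℝ, (fun i => (B * R) i 0) = t • u) :
    ((fun c : Fin (k + 1) => R c 0) = (fun c => if c = 0 then (1 : ℝ) else 0) ∨
      (fun c : Fin (k + 1) => R c 0) = (fun c => if c = 0 then (-1 : ℝ) else 0)) ∧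
    ((fun i => (B * R) i 0) = u ∨ (fun i => (B * R) i 0) = -u) := by
  obtain ⟨t, ht⟩ := hcol
  have hentry : ∀ i, (B * R) i 0 =
      u i * R 0 0 + ∑ c : Fin k, (u i * α c + P i c) * R c.succ 0 := by
    intro i
    rw [Matrix.mul_apply, Fin.sum_univ_succ, hB i]
    simp
  set s : ℝ := t - R 0 0 - ∑ c : Fin k, α c * R c.succ 0 with hs
  have hPr : ∀ i, ∑ c : Fin k, P i c * R c.succ 0 = s * u i := by
    intro i
    have h1 : (B * R) i 0 = t * u i := congrFun ht i
    have h2 : ∑ c : Fin k, (u i * α c + P i c) * R c.succ 0 =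
        u i * ∑ c : Fin k, α c * R c.succ 0 + ∑ c : Fin k, P i c * R c.succ 0 := by
      rw [Finset.mul_sum, ← Finset.sum_add_distrib]
      exact Finset.sum_congr rfl fun c _ => by ring
    rw [hentry i, h2] at h1
    rw [hs]
    linarith
  have hsu : s * (u ⬝ᵥ u) = 0 := by
    calc s * (u ⬝ᵥ u) = ∑ i, (∑ c : Fin k, P i c * R c.succ 0) * u i := by
          simp only [hPr, dotProduct, Finset.mul_sum, mul_assoc]
      _ = ∑ c : Fin k, R c.succ 0 * ∑ i, P i c * u i := by
          simp only [Finset.sum_mul, Finset.mul_sum]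
          rw [Finset.sum_comm]
          exact Finset.sum_congr rfl fun c _ => Finset.sum_congr rfl fun i _ => by ring
      _ = 0 := by simp [hPu]
  have hs0 : s = 0 :=
    (mul_eq_zero.mp hsu).resolve_right fun h => hu (dotProduct_self_eq_zero.mp h)
  have hr : ∀ c : Fin k, R c.succ 0 = 0 := by
    refine Fintype.linearIndependent_iff.mp hPrank (fun c => R c.succ 0) ?_
    ext i
    simpa [hs0, mul_comm] using hPr i
  have hnorm : R 0 0 * R 0 0 = 1 := by
    have h := congrFun (congrFun hR 0) 0
    simpa [Matrix.mul_apply, Fin.sum_univ_succ, hr] using h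
  rcases mul_self_eq_one_iff.mp hnorm with h | h
  · refine ⟨Or.inl ?_, Or.inl ?_⟩
    · ext c
      refine Fin.cases ?_ (fun c => ?_) c <;> simp [h, hr]
    · ext i
      simp [hentry, hr, h]
  · refine ⟨Or.inr ?_, Or.inr ?_⟩
    · ext c
      refine Fin.cases ?_ (fun c => ?_) c <;> simp [h, hr]
    · ext i
      simp [hentry, hr, h]
end
end
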